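/- The subspace F(A) is Lagrangian in V × V*: it equals its own orthogonal complement with respect to the canonical symmetric pairing ⟨·,·⟩₀; equivalently, F(A) is isotropic and dim F(A) = dim V. (This is the maximality part of Proposition 3.4 of the paper, fibrewise.) -/

import Mathlib

/-- The symmetric bilinear pairing on `E = 𝔻 × (V × V*)`:
`⟪(d₁,(u₁,α₁)),(d₂,(u₂,α₂))⟫ = ⟨d₁,d₂⟩ + (1/2)(α₁(u₂) + α₂(u₁))`. -/
noncomputable def pairE {D V : Type*} [AddCommGroup D] [Module ℝ D] [AddCommGroup V] [Module ℝ V]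
    (B : LinearMap.BilinForm ℝ D) (p q : D × V × Module.Dual ℝ V) : ℝ :=
  B p.1 q.1 + (1 / 2) * (p.2.2 q.2.1 + q.2.2 p.2.1)

section PairingForm

variable {D V : Type*} [AddCommGroup D] [Module ℝ D] [AddCommGroup V] [Module ℝ V]

/-- `pairE B` as a bilinear form. -/
noncomputable def pairEForm (B : LinearMap.BilinForm ℝ D) :
    LinearMap.BilinForm ℝ (D × V × Module.Dual ℝ V) :=
  LinearMap.mk₂ ℝ (pairE B)
    (fun _ _ _ => by simp [pairE]; ring) (fun _ _ _ => by simp [pairE]; ring)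
    (fun _ _ _ => by simp [pairE]; ring) (fun _ _ _ => by simp [pairE]; ring)

@[simp]
theorem pairEForm_apply (B : LinearMap.BilinForm ℝ D) (p q : D × V × Module.Dual ℝ V) :
    pairEForm B p q = B p.1 q.1 + (1 / 2) * (p.2.2 q.2.1 + q.2.2 p.2.1) :=
  rfl

theorem pairEForm_isSymm {B : LinearMap.BilinForm ℝ D} (hB : B.IsSymm) :
    (pairEForm (V := V) B).IsSymm :=
  ⟨fun p q => by
    simp only [pairEForm_apply, hB.eq p.1 q.1, add_comm]⟩

theorem pairEForm_nondegenerate {B : LinearMap.BilinForm ℝ D} (hB : B.IsSymm)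
    (hBnd : B.Nondegenerate) : (pairEForm (V := V) B).Nondegenerate := by
  suffices h : LinearMap.SeparatingLeft (pairEForm (V := V) B) from
    ⟨h, fun q hq => h q fun p => (pairEForm_isSymm hB).isRefl _ _ (hq p)⟩
  rintro ⟨d, u, α⟩ h
  have hd : d = 0 := hBnd.1 d fun x => by simpa using h (x, 0, 0)
  have hu : u = 0 := (Module.forall_dual_apply_eq_zero_iff ℝ u).mp fun β => by
    simpa using h (0, 0, β)
  have hα : α = 0 := LinearMap.ext fun v => by simpa using h (0, v, 0)
  simp [hd, hu, hα]

end PairingForm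

theorem stmt
    {D V : Type*} [AddCommGroup D] [Module ℝ D] [FiniteDimensional ℝ D]
    [AddCommGroup V] [Module ℝ V] [FiniteDimensional ℝ V]
    (B : LinearMap.BilinForm ℝ D) (hBsymm : B.IsSymm) (hBnd : B.Nondegenerate)
    (A : Submodule ℝ D)
    -- `A = A^⊥` (A is Lagrangian in 𝔻)
    (hA : (A : Set D) = {d : D | ∀ a ∈ A, B d a = 0})
    (F : Submodule ℝ (D × V × Module.Dual ℝ V))
    -- `F = F^⊥` with respect to the pairing `pairE B` (F is Lagrangian in E)
    (hF : (F : Set (D × V × Module.Dual ℝ V)) =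
      {e : D × V × Module.Dual ℝ V | ∀ f ∈ F, pairE B e f = 0})
    -- (i) `F` intersects `{0} × (V × {0})` trivially
    (hFi : ∀ u : V, ((0 : D), u, (0 : Module.Dual ℝ V)) ∈ F → u = 0)
    -- (ii) the image of `F ∩ (𝔻 × (V × {0}))` under the projection `E → 𝔻` equals `A`
    (hFii : ∀ d : D, d ∈ A ↔ ∃ u : V, (d, u, (0 : Module.Dual ℝ V)) ∈ F)
    :
    ∀ q : V × Module.Dual ℝ V,
      (∃ a ∈ A, (a, q.1, q.2) ∈ F) ↔
        (∀ p : V × Module.Dual ℝ V, (∃ a ∈ A, (a, p.1, p.2) ∈ F) →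
          (1 / 2 : ℝ) * (p.2 q.1 + q.2 p.1) = 0) := by
  have memA : ∀ d, d ∈ A ↔ ∀ a ∈ A, B d a = 0 := fun d => Set.ext_iff.mp hA d
  have memF : ∀ e, e ∈ F ↔ ∀ f ∈ F, pairEForm B e f = 0 := fun e => Set.ext_iff.mp hF e
  have hsymm := pairEForm_isSymm (V := V) hBsymm
  rintro ⟨u, α⟩
  constructor
  · rintro ⟨a, ha, haF⟩ ⟨v, β⟩ ⟨b, hb, hbF⟩
    have h := (memF _).mp haF _ hbF
    simp only [pairEForm_apply, (memA a).mp ha b hb, zero_add] at h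
    rw [add_comm]
    exact h
  · intro h
    let G := F ⊔ A.map (LinearMap.inl ℝ D (V × Module.Dual ℝ V))
    have hG : ((0, u, α) : D × V × Module.Dual ℝ V) ∈ G := by
      rw [← LinearMap.BilinForm.orthogonal_orthogonal
        (pairEForm_nondegenerate hBsymm hBnd) hsymm.isRefl G]
      rintro ⟨b, v, β⟩ hb
      have hbF : (b, v, β) ∈ F := (memF _).mpr fun f hf =>
        hsymm.isRefl _ _ (hb f (Submodule.mem_sup_left hf))
      have hbA : b ∈ A := (memA b).mpr fun a ha => by
        simpa using hsymm.isRefl _ _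
          (hb _ (Submodule.mem_sup_right (Submodule.mem_map_of_mem ha)))
      simpa using h (v, β) ⟨b, hbA, hbF⟩
    obtain ⟨f, hf, _, ⟨a, ha, rfl⟩, hfa⟩ := Submodule.mem_sup.mp hG
    refine ⟨-a, A.neg_mem ha, ?_⟩
    have hf' : f = (-a, u, α) := by
      rw [eq_sub_of_add_eq hfa]
      simp
    exact hf' ▸ hf
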